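/- Let k ∈ ℝ and suppose a measurable kernel k₀ : ℝ³ × ℝ³ → ℝ satisfies |k₀(v,η)| ≤ C₁ |v-η|^γ e^{-|v|²/4} e^{-|η|²/4} + C₂ |v-η|^{-(3-γ)/2} e^{-|v-η|²/8} e^{-||v|²-|η|²|²/(8|v-η|²)} for some -3 < γ ≤ 1. Then there is a constant C_k such that for all v ∈ ℝ³, ∫_{ℝ³} |k₀(v,η)| · ((1+|v|)/(1+|η|))^k · e^{|v-η|²/20} dη ≤ C_k (1+|v|)^{-1}. -/

import Mathlib

open Real MeasureTheory

open scoped ENNReal InnerProductSpace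

local notation "ℝ³" => EuclideanSpace ℝ (Fin 3)

/-- The substitution `r = √(x² + ρ²)` for integrals over `ρ > 0`. -/
lemma lintegral_Ioi_comp_sqrt_le (x : ℝ) (g : ℝ → ℝ≥0∞) :
    ∫⁻ ρ in Set.Ioi (0 : ℝ), ENNReal.ofReal ρ * g √(x ^ 2 + ρ ^ 2) ≤
      ∫⁻ r in Set.Ioi |x|, ENNReal.ofReal r * g r := by
  have hpos : ∀ ρ ∈ Set.Ioi (0 : ℝ), 0 < x ^ 2 + ρ ^ 2 := fun ρ hρ => by
    have : 0 < ρ := hρ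
    positivity
  have hderiv : ∀ ρ ∈ Set.Ioi (0 : ℝ), HasDerivWithinAt (fun ρ : ℝ => √(x ^ 2 + ρ ^ 2))
      (ρ / √(x ^ 2 + ρ ^ 2)) (Set.Ioi 0) ρ := fun ρ hρ => by
    have h := (((hasDerivAt_pow 2 ρ).const_add (x ^ 2)).sqrt (hpos ρ hρ).ne').hasDerivWithinAt
      (s := Set.Ioi 0)
    convert! h using 1
    have := (sqrt_pos.2 (hpos ρ hρ)).ne'
    field_simp
    simp [mul_comm]
  have hinj : Set.InjOn (fun ρ : ℝ => √(x ^ 2 + ρ ^ 2)) (Set.Ioi 0) := fun a ha b hb hab => by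
    have ha' : 0 < a := ha
    have hb' : 0 < b := hb
    have h := (sqrt_inj (hpos a ha).le (hpos b hb).le).1 hab
    exact (pow_left_inj₀ ha'.le hb'.le two_ne_zero).1 (by linarith)
  have himage : (fun ρ : ℝ => √(x ^ 2 + ρ ^ 2)) '' Set.Ioi 0 ⊆ Set.Ioi |x| := by
    rintro _ ⟨ρ, hρ, rfl⟩
    have : 0 < ρ := hρ
    rw [Set.mem_Ioi, ← sqrt_sq_eq_abs]
    exact sqrt_lt_sqrt (sq_nonneg x) (by nlinarith)
  calc ∫⁻ ρ in Set.Ioi (0 : ℝ), ENNReal.ofReal ρ * g √(x ^ 2 + ρ ^ 2)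
      = ∫⁻ ρ in Set.Ioi (0 : ℝ), ENNReal.ofReal |ρ / √(x ^ 2 + ρ ^ 2)| *
          (ENNReal.ofReal √(x ^ 2 + ρ ^ 2) * g √(x ^ 2 + ρ ^ 2)) := by
        refine setLIntegral_congr_fun measurableSet_Ioi fun ρ hρ => ?_
        have h0 : 0 < ρ := hρ
        have hs := sqrt_pos.2 (hpos ρ hρ)
        rw [← mul_assoc, ← ENNReal.ofReal_mul (abs_nonneg _), abs_of_pos (div_pos h0 hs),
          div_mul_cancel₀ _ hs.ne']
    _ = ∫⁻ r in (fun ρ : ℝ => √(x ^ 2 + ρ ^ 2)) '' Set.Ioi 0, ENNReal.ofReal r * g r :=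
        (lintegral_image_eq_lintegral_abs_deriv_mul measurableSet_Ioi hderiv hinj
          (fun r => ENNReal.ofReal r * g r)).symm
    _ ≤ _ := lintegral_mono_set himage

lemma lintegral_prod_comp_sqrt_le (x : ℝ) {g : ℝ → ℝ≥0∞} (hg : Measurable g) :
    ∫⁻ y : ℝ × ℝ, g √(x ^ 2 + (y.1 ^ 2 + y.2 ^ 2)) ≤
      ENNReal.ofReal (2 * π) * ∫⁻ r in Set.Ioi |x|, ENNReal.ofReal r * g r := by
  rw [← lintegral_comp_polarCoord_symm]
  have h : ∀ p : ℝ × ℝ, ENNReal.ofReal p.1 • g √(x ^ 2 +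
      ((polarCoord.symm p).1 ^ 2 + (polarCoord.symm p).2 ^ 2)) =
      ENNReal.ofReal p.1 * g √(x ^ 2 + p.1 ^ 2) := fun p => by
    rw [polarCoord_symm_apply, smul_eq_mul]
    congr 3
    linear_combination p.1 ^ 2 * sin_sq_add_cos_sq p.2
  simp_rw [h]
  rw [show polarCoord.target = Set.Ioi (0 : ℝ) ×ˢ Set.Ioo (-π) π from rfl, Measure.volume_eq_prod,
    setLIntegral_prod _ (by fun_prop)]
  simp only [setLIntegral_const, Real.volume_Ioo]
  rw [lintegral_mul_const _ (by fun_prop), mul_comm, sub_neg_eq_add, ← two_mul]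
  gcongr ENNReal.ofReal (2 * π) * ?_
  exact lintegral_Ioi_comp_sqrt_le x g

/-- Integration of a function of the norm and of one coordinate over `ℝ³`. -/
lemma lintegral_norm_coord_le {H : ℝ → ℝ → ℝ≥0∞} (hH : Measurable (Function.uncurry H)) :
    ∫⁻ u : ℝ³, H ‖u‖ (u 0) ≤ ENNReal.ofReal (2 * π) *
      ∫⁻ r in Set.Ioi (0 : ℝ), ENNReal.ofReal r * ∫⁻ x in Set.Ioo (-r) r, H r x := by
  let φ : ℝ × (Fin 2 → ℝ) → ℝ × (ℝ × ℝ) := Prod.map id (MeasurableEquiv.finTwoArrow (α := ℝ))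
  have h₁ := (PiLp.volume_preserving_ofLp (Fin 3))
  have h₂ := volume_preserving_piFinSuccAbove (fun _ : Fin 3 => ℝ) 0
  have h₃ : MeasurePreserving φ :=
    (MeasurePreserving.id volume).prod (volume_preserving_finTwoArrow ℝ)
  have hmp := h₃.comp (h₂.comp h₁)
  have hG : Measurable fun p : ℝ × (ℝ × ℝ) =>
      H √(p.1 ^ 2 + (p.2.1 ^ 2 + p.2.2 ^ 2)) p.1 :=
    hH.comp (f := fun p : ℝ × (ℝ × ℝ) => (√(p.1 ^ 2 + (p.2.1 ^ 2 + p.2.2 ^ 2)), p.1))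
      (by fun_prop)
  have hcongr : ∀ u : ℝ³, H ‖u‖ (u 0) = (fun p : ℝ × (ℝ × ℝ) =>
      H √(p.1 ^ 2 + (p.2.1 ^ 2 + p.2.2 ^ 2)) p.1) ((φ ∘ MeasurableEquiv.piFinSuccAbove
        (fun _ : Fin 3 => ℝ) 0 ∘ WithLp.ofLp) u) := fun u => by
    have : ‖u‖ = √(u 0 ^ 2 + (u 1 ^ 2 + u 2 ^ 2)) := by
      rw [EuclideanSpace.norm_eq, Fin.sum_univ_three]
      simp [add_assoc]
    rw [this]
    rfl
  simp_rw [hcongr]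
  rw [hmp.lintegral_comp hG, Measure.volume_eq_prod, lintegral_prod _ hG.aemeasurable]
  have hset : MeasurableSet {q : ℝ × ℝ | |q.1| < q.2} :=
    measurableSet_lt (by fun_prop) (by fun_prop)
  let T : ℝ × ℝ → ℝ≥0∞ := {q : ℝ × ℝ | |q.1| < q.2}.indicator
    fun q => ENNReal.ofReal q.2 * H q.2 q.1
  have hT : Measurable T := by
    refine Measurable.indicator ?_ hset
    exact (by fun_prop : Measurable fun q : ℝ × ℝ => ENNReal.ofReal q.2).mul
      (hH.comp measurable_swap)
  calc ∫⁻ x : ℝ, ∫⁻ y : ℝ × ℝ, H √(x ^ 2 + (y.1 ^ 2 + y.2 ^ 2)) x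
      ≤ ∫⁻ x : ℝ, ENNReal.ofReal (2 * π) * ∫⁻ r in Set.Ioi |x|, ENNReal.ofReal r * H r x :=
        lintegral_mono fun x => lintegral_prod_comp_sqrt_le x (g := fun r => H r x)
          (hH.comp (f := fun r : ℝ => (r, x)) (by fun_prop))
    _ = ENNReal.ofReal (2 * π) * ∫⁻ x : ℝ, ∫⁻ r : ℝ, T (x, r) := by
        rw [lintegral_const_mul' _ _ ENNReal.ofReal_ne_top]
        congr 1
        refine lintegral_congr fun x => ?_
        rw [← lintegral_indicator measurableSet_Ioi]
        rfl
    _ = ENNReal.ofReal (2 * π) * ∫⁻ r : ℝ, ∫⁻ x : ℝ, T (x, r) := by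
        rw [lintegral_lintegral_swap (f := fun x r => T (x, r)) hT.aemeasurable]
    _ = _ := by
        congr 1
        rw [← lintegral_indicator measurableSet_Ioi]
        refine lintegral_congr fun r => ?_
        by_cases hr : 0 < r
        · rw [Set.indicator_of_mem (Set.mem_Ioi.2 hr), ← lintegral_const_mul' _ _
            ENNReal.ofReal_ne_top, ← lintegral_indicator measurableSet_Ioo]
          refine lintegral_congr fun x => ?_
          simp only [T, Set.indicator, Set.mem_ofPred_eq, Set.mem_Ioo, abs_lt]
        · rw [Set.indicator_of_notMem (by simpa using hr)]
          refine (lintegral_congr fun x => ?_).trans lintegral_zero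
          exact Set.indicator_of_notMem (s := {q : ℝ × ℝ | |q.1| < q.2})
            (fun h => hr ((abs_nonneg x).trans_lt h)) _

lemma exists_orthonormalBasis_eq_norm_smul (v : ℝ³) :
    ∃ b : OrthonormalBasis (Fin 3) ℝ ℝ³, v = ‖v‖ • b 0 := by
  by_cases hv : v = 0
  · exact ⟨EuclideanSpace.basisFun (Fin 3) ℝ, by simp [hv]⟩
  have hv' : ‖v‖ ≠ 0 := norm_ne_zero_iff.2 hv
  have hon : Orthonormal ℝ (({0} : Set (Fin 3)).domRestrict fun _ => ‖v‖⁻¹ • v) := by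
    refine ⟨fun i => ?_, fun i j hij => absurd (Subsingleton.elim i j) hij⟩
    simp [Set.domRestrict, norm_smul, hv']
  obtain ⟨b, hb⟩ := hon.exists_orthonormalBasis_extension_of_card_eq (by simp)
  exact ⟨b, by rw [hb 0 rfl, smul_inv_smul₀ hv']⟩

/-- Integration of a function of `‖u‖` and `⟪v, u⟫` over `ℝ³`. -/
lemma lintegral_norm_inner_le {H : ℝ → ℝ → ℝ≥0∞} (hH : Measurable (Function.uncurry H)) (v : ℝ³) :
    ∫⁻ u : ℝ³, H ‖u‖ ⟪v, u⟫_ℝ ≤ ENNReal.ofReal (2 * π) *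
      ∫⁻ r in Set.Ioi (0 : ℝ), ENNReal.ofReal r * ∫⁻ x in Set.Ioo (-r) r, H r (‖v‖ * x) := by
  obtain ⟨b, hb⟩ := exists_orthonormalBasis_eq_norm_smul v
  have hH' : Measurable (Function.uncurry fun r x => H r (‖v‖ * x)) :=
    hH.comp (f := fun p : ℝ × ℝ => (p.1, ‖v‖ * p.2)) (by fun_prop)
  refine le_trans (le_of_eq ?_) (lintegral_norm_coord_le hH')
  rw [← b.measurePreserving_repr.lintegral_comp_emb b.measurableEquiv.measurableEmbedding
    (fun w => H ‖w‖ (‖v‖ * w 0))]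
  refine lintegral_congr fun u => ?_
  rw [LinearIsometryEquiv.norm_map, b.repr_apply_apply, ← real_inner_smul_left, ← hb]

lemma lintegral_exp_neg_sq_affine {c : ℝ} (hc : c ≠ 0) (d : ℝ) :
    ∫⁻ x : ℝ, ENNReal.ofReal (exp (-(c * x + d) ^ 2 / 8)) =
      ENNReal.ofReal (|c⁻¹| * √(8 * π)) := by
  have hf : Integrable fun x : ℝ => exp (-(1 / 8) * x ^ 2) :=
    integrable_exp_neg_mul_sq (by norm_num)
  have hint := (hf.comp_add_right d).comp_mul_left' hc
  have hval := Measure.integral_comp_mul_left (fun x : ℝ => exp (-(1 / 8) * (x + d) ^ 2)) c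
  rw [integral_add_right_eq_self (fun x : ℝ => exp (-(1 / 8) * x ^ 2)), integral_gaussian,
    smul_eq_mul, show π / (1 / 8) = 8 * π by ring] at hval
  rw [← hval, ofReal_integral_eq_lintegral_ofReal hint (.of_forall fun x => (exp_pos _).le)]
  refine lintegral_congr fun x => ?_
  congr 2
  ring

lemma setLIntegral_Ioo_exp_neg_sq_le {m r : ℝ} (hm : 0 ≤ m) (hr : 0 < r) :
    ∫⁻ x in Set.Ioo (-r) r,
      ENNReal.ofReal (exp (-(2 * (m * x) - r ^ 2) ^ 2 / (8 * r ^ 2))) ≤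
      ENNReal.ofReal (6 * r / (1 + m)) := by
  rcases le_total m 1 with h | h
  · calc _ ≤ ∫⁻ x in Set.Ioo (-r) r, 1 := lintegral_mono fun x => by
          rw [ENNReal.ofReal_le_one, exp_le_one_iff, neg_div, neg_nonpos]
          positivity
      _ ≤ _ := by
          rw [setLIntegral_const, Real.volume_Ioo, one_mul]
          apply ENNReal.ofReal_le_ofReal
          rw [le_div_iff₀ (by positivity)]
          nlinarith
  · have hm0 : 0 < m := by linarith
    calc _ ≤ ∫⁻ x : ℝ, ENNReal.ofReal (exp (-(2 * (m * x) - r ^ 2) ^ 2 / (8 * r ^ 2))) :=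
          setLIntegral_le_lintegral _ _
      _ = ∫⁻ x : ℝ, ENNReal.ofReal (exp (-(2 * m / r * x + -r) ^ 2 / 8)) := by
          refine lintegral_congr fun x => ?_
          congr 2
          field_simp
          ring
      _ ≤ _ := by
          rw [lintegral_exp_neg_sq_affine (by positivity)]
          apply ENNReal.ofReal_le_ofReal
          have hs : √(8 * π) ≤ 6 := by
            rw [sqrt_le_left (by norm_num)]
            linarith [pi_lt_four]
          rw [abs_of_pos (by positivity), inv_div, le_div_iff₀ (by positivity)]
          have : r / (2 * m) * √(8 * π) * (1 + m) ≤ r / (2 * m) * 6 * (2 * m) := by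
            gcongr
            linarith
          refine this.trans (le_of_eq ?_)
          field_simp

lemma integrable_norm_rpow_mul_exp_neg_mul_sq {s β : ℝ} (hs : -3 < s) (hβ : 0 < β) :
    Integrable fun u : ℝ³ => ‖u‖ ^ s * exp (-β * ‖u‖ ^ 2) := by
  rw [integrable_fun_norm_addHaar volume (f := fun r : ℝ => r ^ s * exp (-β * r ^ 2))]
  refine (integrableOn_rpow_mul_exp_neg_mul_sq hβ (s := s + 2) (by linarith)).congr_fun ?_
    measurableSet_Ioi
  intro r (hr : 0 < r)
  simp [rpow_add hr, mul_assoc, mul_left_comm]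

/-- The radially singular Gaussian kernel with Grad's angular factor gains one power of `‖v‖`. -/
lemma exists_lintegral_grad_gaussian_le {s β : ℝ} (hs : -3 < s) (hβ : 0 < β) :
    ∃ C : ℝ, 0 ≤ C ∧ ∀ v : ℝ³, ∫⁻ u : ℝ³, ENNReal.ofReal (‖u‖ ^ s * exp (-β * ‖u‖ ^ 2) *
      exp (-(2 * ⟪v, u⟫_ℝ - ‖u‖ ^ 2) ^ 2 / (8 * ‖u‖ ^ 2))) ≤ ENNReal.ofReal (C * (1 + ‖v‖)⁻¹) := by
  have hint := integrableOn_rpow_mul_exp_neg_mul_sq hβ (s := s + 2) (by linarith)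
  have hI : 0 ≤ ∫ r in Set.Ioi (0 : ℝ), r ^ (s + 2) * exp (-β * r ^ 2) :=
    setIntegral_nonneg measurableSet_Ioi fun r (hr : 0 < r) => by positivity
  refine ⟨2 * π * 6 * ∫ r in Set.Ioi (0 : ℝ), r ^ (s + 2) * exp (-β * r ^ 2), by positivity,
    fun v => ?_⟩
  have hH : Measurable (Function.uncurry fun r x : ℝ => ENNReal.ofReal (r ^ s * exp (-β * r ^ 2) *
      exp (-(2 * x - r ^ 2) ^ 2 / (8 * r ^ 2)))) := by
    unfold Function.uncurry
    fun_prop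
  have hv : 0 < 1 + ‖v‖ := by positivity
  calc _ ≤ ENNReal.ofReal (2 * π) * ∫⁻ r in Set.Ioi (0 : ℝ), ENNReal.ofReal r *
        ∫⁻ x in Set.Ioo (-r) r, ENNReal.ofReal (r ^ s * exp (-β * r ^ 2) *
          exp (-(2 * (‖v‖ * x) - r ^ 2) ^ 2 / (8 * r ^ 2))) := lintegral_norm_inner_le hH v
    _ ≤ ENNReal.ofReal (2 * π) * ∫⁻ r in Set.Ioi (0 : ℝ), ENNReal.ofReal (6 * (1 + ‖v‖)⁻¹) *
        ENNReal.ofReal (r ^ (s + 2) * exp (-β * r ^ 2)) := by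
        gcongr ENNReal.ofReal (2 * π) * ?_
        refine setLIntegral_mono' measurableSet_Ioi fun r (hr : 0 < r) => ?_
        have hnn : 0 ≤ r ^ s * exp (-β * r ^ 2) := by positivity
        simp_rw [ENNReal.ofReal_mul hnn]
        rw [lintegral_const_mul' _ _ ENNReal.ofReal_ne_top]
        calc _ ≤ ENNReal.ofReal r * (ENNReal.ofReal (r ^ s * exp (-β * r ^ 2)) *
              ENNReal.ofReal (6 * r / (1 + ‖v‖))) := by
              gcongr
              exact setLIntegral_Ioo_exp_neg_sq_le (norm_nonneg v) hr
          _ = _ := by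
              rw [← ENNReal.ofReal_mul hnn, ← ENNReal.ofReal_mul hr.le,
                ← ENNReal.ofReal_mul (by positivity), rpow_add hr, rpow_two]
              congr 1
              field_simp
    _ = _ := by
        rw [lintegral_const_mul' _ _ ENNReal.ofReal_ne_top,
          ← ofReal_integral_eq_lintegral_ofReal hint
            ((ae_restrict_mem measurableSet_Ioi).mono fun r (hr : 0 < r) => by
              simp only [Pi.zero_apply]; positivity),
          ← ENNReal.ofReal_mul (by positivity), ← ENNReal.ofReal_mul (by positivity)]
        congr 1
        ring

lemma one_add_div_rpow_le {a b r : ℝ} (ha : 0 ≤ a) (hb : 0 ≤ b) (hr : |a - b| ≤ r) (k : ℝ) :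
    ((1 + a) / (1 + b)) ^ k ≤ exp (10 * k ^ 2) * exp (r ^ 2 / 40) := by
  have ha' : 0 < 1 + a := by positivity
  have hb' : 0 < 1 + b := by positivity
  obtain ⟨h₁, h₂⟩ := abs_le.1 hr
  have hr0 : 0 ≤ r := (abs_nonneg _).trans hr
  have hlog : ∀ {x y : ℝ}, 0 ≤ x → 0 ≤ y → x - y ≤ r → log ((1 + x) / (1 + y)) ≤ r :=
    fun {x y} hx hy h => by
      refine (log_le_sub_one_of_pos (by positivity)).trans ?_
      rw [sub_le_iff_le_add, div_le_iff₀ (by positivity)]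
      nlinarith
  have h₃ : |log ((1 + a) / (1 + b))| ≤ r := by
    rw [abs_le]
    refine ⟨?_, hlog ha hb h₂⟩
    have := hlog hb ha (by linarith)
    rw [← inv_div, log_inv] at this
    linarith
  rw [rpow_def_of_pos (div_pos ha' hb'), ← exp_add, exp_le_exp]
  obtain ⟨h₄, h₅⟩ := abs_le.1 h₃
  have h₆ := sq_le_sq' h₄ h₅
  nlinarith [sq_nonneg (log ((1 + a) / (1 + b)) - 20 * k)]

lemma exp_neg_sq_div_le (m : ℝ) (hm : 0 ≤ m) : exp (-m ^ 2 / 20) ≤ exp 5 * (1 + m)⁻¹ := by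
  rw [← div_eq_mul_inv, le_div_iff₀ (by positivity)]
  calc exp (-m ^ 2 / 20) * (1 + m) ≤ exp (-m ^ 2 / 20) * exp m := by
        gcongr
        linarith [add_one_le_exp m]
    _ ≤ exp 5 := by
        rw [← exp_add, exp_le_exp]
        nlinarith [sq_nonneg (m - 10)]

/-- Absorption of the polynomial weight and of the factor `exp (‖v - η‖² / 20)` into the Gaussian
factors of Grad's kernel bound. -/
lemma grad_bound_mul_weight_le (γ s k : ℝ) {C₁ C₂ : ℝ} (hC₁ : 0 ≤ C₁) (hC₂ : 0 ≤ C₂) (v η : ℝ³) :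
    (C₁ * ‖v - η‖ ^ γ * exp (-‖v‖ ^ 2 / 4) * exp (-‖η‖ ^ 2 / 4)
      + C₂ * ‖v - η‖ ^ s * exp (-‖v - η‖ ^ 2 / 8) *
          exp (-(|‖v‖ ^ 2 - ‖η‖ ^ 2|) ^ 2 / (8 * ‖v - η‖ ^ 2))) *
      ((1 + ‖v‖) / (1 + ‖η‖)) ^ k * exp (‖v - η‖ ^ 2 / 20) ≤
    exp (10 * k ^ 2) * C₁ * exp (-‖v‖ ^ 2 / 20) *
        (‖v - η‖ ^ γ * exp (-(1 / 40) * ‖v - η‖ ^ 2)) +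
      exp (10 * k ^ 2) * C₂ * (‖v - η‖ ^ s * exp (-(1 / 20) * ‖v - η‖ ^ 2) *
        exp (-(2 * ⟪v, v - η⟫_ℝ - ‖v - η‖ ^ 2) ^ 2 / (8 * ‖v - η‖ ^ 2))) := by
  have hinner : ‖v‖ ^ 2 - ‖η‖ ^ 2 = 2 * ⟪v, v - η⟫_ℝ - ‖v - η‖ ^ 2 := by
    rw [norm_sub_sq_real, inner_sub_right, real_inner_self_eq_norm_sq]
    ring
  have hpar : ‖v - η‖ ^ 2 ≤ 2 * ‖v‖ ^ 2 + 2 * ‖η‖ ^ 2 := by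
    nlinarith [norm_sub_le v η, norm_nonneg (v - η), sq_nonneg (‖v‖ - ‖η‖)]
  have hw := one_add_div_rpow_le (norm_nonneg v) (norm_nonneg η) (abs_norm_sub_norm_le v η) k
  rw [sq_abs, hinner]
  set r := ‖v - η‖
  set G := exp (-(2 * ⟪v, v - η⟫_ℝ - r ^ 2) ^ 2 / (8 * r ^ 2))
  have hr : 0 ≤ r := norm_nonneg _
  have h₁ : exp (-‖v‖ ^ 2 / 4) * exp (-‖η‖ ^ 2 / 4) * exp (r ^ 2 / 40) * exp (r ^ 2 / 20) ≤
      exp (-‖v‖ ^ 2 / 20) * exp (-(1 / 40) * r ^ 2) := by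
    simp only [← exp_add, exp_le_exp]
    nlinarith [sq_nonneg ‖η‖]
  have h₂ : exp (-r ^ 2 / 8) * exp (r ^ 2 / 40) * exp (r ^ 2 / 20) = exp (-(1 / 20) * r ^ 2) := by
    simp only [← exp_add]
    congr 1
    ring
  calc _ ≤ (C₁ * r ^ γ * exp (-‖v‖ ^ 2 / 4) * exp (-‖η‖ ^ 2 / 4) +
        C₂ * r ^ s * exp (-r ^ 2 / 8) * G) * (exp (10 * k ^ 2) * exp (r ^ 2 / 40)) *
          exp (r ^ 2 / 20) := by
        gcongr
    _ = exp (10 * k ^ 2) * C₁ * r ^ γ * (exp (-‖v‖ ^ 2 / 4) * exp (-‖η‖ ^ 2 / 4) *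
          exp (r ^ 2 / 40) * exp (r ^ 2 / 20)) + exp (10 * k ^ 2) * C₂ * r ^ s * G *
            (exp (-r ^ 2 / 8) * exp (r ^ 2 / 40) * exp (r ^ 2 / 20)) := by ring
    _ ≤ exp (10 * k ^ 2) * C₁ * r ^ γ * (exp (-‖v‖ ^ 2 / 20) * exp (-(1 / 40) * r ^ 2)) +
          exp (10 * k ^ 2) * C₂ * r ^ s * G * exp (-(1 / 20) * r ^ 2) := by
        rw [h₂]
        gcongr
    _ = _ := by ring

/-- Weighted kernel estimate for the Grad-splitting integral operator `K`. -/
theorem grad_kernel_weighted_estimate (γ k C₁ C₂ : ℝ)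
    (hγ0 : -3 < γ) (hγ1 : γ ≤ 1) (hC₁ : 0 ≤ C₁) (hC₂ : 0 ≤ C₂)
    (k₀ : EuclideanSpace ℝ (Fin 3) → EuclideanSpace ℝ (Fin 3) → ℝ)
    (hmeas : Measurable (Function.uncurry k₀))
    (hbound : ∀ v η, |k₀ v η| ≤
      C₁ * ‖v - η‖ ^ γ * Real.exp (-‖v‖^2 / 4) * Real.exp (-‖η‖^2 / 4)
      + C₂ * ‖v - η‖ ^ (-(3 - γ)/2) * Real.exp (-‖v - η‖^2 / 8) *
          Real.exp (-(|‖v‖^2 - ‖η‖^2|)^2 / (8 * ‖v - η‖^2))) :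
    ∃ C > 0, ∀ v : EuclideanSpace ℝ (Fin 3),
      (∫ η : EuclideanSpace ℝ (Fin 3),
        |k₀ v η| * ((1 + ‖v‖) / (1 + ‖η‖)) ^ k * Real.exp (‖v - η‖^2 / 20))
          ≤ C * (1 + ‖v‖)⁻¹ := by
  obtain ⟨C, hC, hCv⟩ := exists_lintegral_grad_gaussian_le (s := -(3 - γ) / 2) (β := 1 / 20)
    (by linarith) (by norm_num)
  have hint := integrable_norm_rpow_mul_exp_neg_mul_sq hγ0 (β := 1 / 40) (by norm_num)
  set I := ∫ u : ℝ³, ‖u‖ ^ γ * exp (-(1 / 40) * ‖u‖ ^ 2) with hI_def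
  have hI : 0 ≤ I := integral_nonneg fun u => by positivity
  set M := exp (10 * k ^ 2)
  refine ⟨M * C₁ * exp 5 * I + M * C₂ * C + 1, by positivity, fun v => ?_⟩
  let F : ℝ³ → ℝ := fun u => ‖u‖ ^ γ * exp (-(1 / 40) * ‖u‖ ^ 2)
  let G : ℝ³ → ℝ := fun u => ‖u‖ ^ (-(3 - γ) / 2) * exp (-(1 / 20) * ‖u‖ ^ 2) *
    exp (-(2 * ⟪v, u⟫_ℝ - ‖u‖ ^ 2) ^ 2 / (8 * ‖u‖ ^ 2))
  have hF : ∀ u, 0 ≤ F u := fun u => by positivity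
  have hG : ∀ u, 0 ≤ G u := fun u => by positivity
  have hFm : Measurable F := by fun_prop
  have hv : 0 < 1 + ‖v‖ := by positivity
  have hkey : ∫⁻ η : ℝ³, ENNReal.ofReal
      ‖|k₀ v η| * ((1 + ‖v‖) / (1 + ‖η‖)) ^ k * exp (‖v - η‖ ^ 2 / 20)‖ ≤
      ENNReal.ofReal ((M * C₁ * exp 5 * I + M * C₂ * C + 1) * (1 + ‖v‖)⁻¹) := by
    calc _ ≤ ∫⁻ η : ℝ³, (fun u => ENNReal.ofReal (M * C₁ * exp (-‖v‖ ^ 2 / 20)) *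
            ENNReal.ofReal (F u) + ENNReal.ofReal (M * C₂) * ENNReal.ofReal (G u)) (v - η) := by
          refine lintegral_mono fun η => ?_
          have hFη := hF (v - η)
          have hGη := hG (v - η)
          simp only
          rw [← ENNReal.ofReal_mul (by positivity), ← ENNReal.ofReal_mul (by positivity),
            ← ENNReal.ofReal_add (by positivity) (by positivity), norm_of_nonneg (by positivity)]
          apply ENNReal.ofReal_le_ofReal
          refine le_trans ?_ (grad_bound_mul_weight_le γ _ k hC₁ hC₂ v η)
          gcongr
          exact hbound v η
      _ = ∫⁻ u : ℝ³, (ENNReal.ofReal (M * C₁ * exp (-‖v‖ ^ 2 / 20)) * ENNReal.ofReal (F u) +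
            ENNReal.ofReal (M * C₂) * ENNReal.ofReal (G u)) :=
          lintegral_sub_left_eq_self (fun u => ENNReal.ofReal (M * C₁ * exp (-‖v‖ ^ 2 / 20)) *
            ENNReal.ofReal (F u) + ENNReal.ofReal (M * C₂) * ENNReal.ofReal (G u)) v
      _ = ENNReal.ofReal (M * C₁ * exp (-‖v‖ ^ 2 / 20)) * ENNReal.ofReal I +
            ENNReal.ofReal (M * C₂) * ∫⁻ u : ℝ³, ENNReal.ofReal (G u) := by
          rw [lintegral_add_left (by fun_prop), lintegral_const_mul' _ _ ENNReal.ofReal_ne_top,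
            lintegral_const_mul' _ _ ENNReal.ofReal_ne_top, hI_def,
            ofReal_integral_eq_lintegral_ofReal hint (.of_forall hF)]
      _ ≤ ENNReal.ofReal (M * C₁ * (exp 5 * (1 + ‖v‖)⁻¹)) * ENNReal.ofReal I +
            ENNReal.ofReal (M * C₂) * ENNReal.ofReal (C * (1 + ‖v‖)⁻¹) := by
          gcongr
          · exact exp_neg_sq_div_le _ (norm_nonneg v)
          · exact hCv v
      _ ≤ _ := by
          rw [← ENNReal.ofReal_mul (by positivity), ← ENNReal.ofReal_mul (by positivity),
            ← ENNReal.ofReal_add (by positivity) (by positivity)]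
          apply ENNReal.ofReal_le_ofReal
          have : 0 ≤ (1 + ‖v‖)⁻¹ := by positivity
          linarith
  refine (Real.le_norm_self _).trans ((norm_integral_le_lintegral_norm _).trans ?_)
  exact ENNReal.toReal_le_of_le_ofReal (by positivity) hkey
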